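/- arXiv:1511.08791 — 3 statements merged into one kernel-verified Lean document; each statement's English description precedes it below -/
import Mathlib

section
/- Let S'_d be the set consisting of all paths that occur (as first or second component) in the mandated-preference relation S_d, together with all of their suffixes. Suppose λ : S'_d → ℤ and w : E → ℤ satisfy: (i) λ_{ε_d} = 0; (ii) for every edge (i,j) ∈ E and every pair of paths q, p ∈ S'_d with p obtained from q by prepending the edge (i,j), λ_p − λ_q = w_{ij}; (iii) for every mandated preference (q,p) ∈ S_d, λ_p − λ_q ≥ 1; and (iv) 0 ≤ w_{ij} ≤ w_max for every edge (i,j). Define Λ on ALL simple paths to d by Λ_p = λ_p for p ∈ S'_d and Λ_p = Σ_{e ∈ p} w_e otherwise. Then Λ satisfies the unrestricted system: Λ_{ε_d} = 0; for every simple path q to d and every one-edge extension p of q by an edge (i,j) ∈ E, Λ_p − Λ_q = w_{ij}; for every (q,p) ∈ S_d, Λ_p − Λ_q ≥ 1; and 0 ≤ Λ_p ≤ |N|·w_max for every simple path p to d. -/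
/-!
Statement 0: Restricted feasibility determines unrestricted feasibility.
`S'` consists of all paths occurring in the mandated-preference relation `S`
together with all of their suffixes.  If `λ` (on `S'`) and the edge weights `w`
satisfy the restricted system (i)-(iv), then the extension `Λ` of `λ` by path
weights satisfies the unrestricted system on all simple paths to `d`.
-/

open SimpleGraph

/-- A simple path to the destination `d`: a start vertex together with a walk to `d`
that is a path. -/
abbrev PathTo {N : Type*} (G : SimpleGraph N) (d : N) : Type _ :=
  Σ v : N, {p : G.Walk v d // p.IsPath}

namespace PathTo

variable {N : Type*} {G : SimpleGraph N} {d : N}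

/-- The underlying walk of a path to `d`. -/
def walk (P : PathTo G d) : G.Walk P.1 d := P.2.1

/-- The weight of a path: the sum of the edge weights over its edges. -/
def weight (w : Sym2 N → ℤ) (P : PathTo G d) : ℤ :=
  (P.walk.edges.map w).sum

/-- The empty path `ε_d` at the destination `d`. -/
def empty (G : SimpleGraph N) (d : N) : PathTo G d :=
  ⟨d, SimpleGraph.Walk.nil, SimpleGraph.Walk.IsPath.nil⟩

/-- `Q` is a suffix of `P`: `P` is obtained from `Q` by prepending a (possibly empty)
sequence of edges. -/
def IsSuffix (Q P : PathTo G d) : Prop :=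
  ∃ r : G.Walk P.1 Q.1, P.walk = r.append Q.walk

/-- `Q` is a proper suffix of `P`: a suffix with `Q ≠ P`. -/
def IsProperSuffix (Q P : PathTo G d) : Prop :=
  IsSuffix Q P ∧ Q ≠ P

/-- `P` is obtained from `Q` by prepending the single edge `(P.1, Q.1)`. -/
def OneStep (P Q : PathTo G d) : Prop :=
  ∃ h : G.Adj P.1 Q.1, P.walk = SimpleGraph.Walk.cons h Q.walk

end PathTo

namespace PathTo

variable {N : Type*} {G : SimpleGraph N} {d : N}

theorem IsSuffix.trans {P Q R : PathTo G d} (hPQ : IsSuffix P Q) (hQR : IsSuffix Q R) :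
    IsSuffix P R := by
  obtain ⟨r, hr⟩ := hPQ
  obtain ⟨s, hs⟩ := hQR
  exact ⟨s.append r, by rw [hs, hr, Walk.append_assoc]⟩

theorem OneStep.isSuffix {P Q : PathTo G d} (h : OneStep P Q) : IsSuffix Q P := by
  obtain ⟨hadj, hP⟩ := h
  exact ⟨Walk.cons hadj Walk.nil, by rw [hP, Walk.cons_append, Walk.nil_append]⟩

theorem weight_empty (w : Sym2 N → ℤ) : weight w (empty G d) = 0 := rfl

theorem OneStep.weight_eq {P Q : PathTo G d} (h : OneStep P Q) (w : Sym2 N → ℤ) :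
    weight w P = w s(P.1, Q.1) + weight w Q := by
  obtain ⟨hadj, hP⟩ := h
  simp [weight, hP]

/-- Paths to `d` are generated from the empty path by prepending edges. -/
theorem oneStep_induction {motive : PathTo G d → Prop} (nil : motive (empty G d))
    (cons : ∀ P Q, OneStep P Q → motive Q → motive P) (P : PathTo G d) : motive P := by
  obtain ⟨v, p, hp⟩ := P
  induction p with
  | nil => exact nil
  | cons h p ih => exact cons _ ⟨_, p, hp.of_cons⟩ ⟨h, rfl⟩ (ih nil cons hp.of_cons)

/-- On a suffix-closed set, a potential compatible with the edge weights is the path weight. -/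
theorem eq_weight_of_suffix_closed {T : Set (PathTo G d)}
    (hT : ∀ P ∈ T, ∀ Q, IsSuffix Q P → Q ∈ T) {w : Sym2 N → ℤ} {f : PathTo G d → ℤ}
    (hf : f (empty G d) = 0)
    (hstep : ∀ P ∈ T, ∀ Q ∈ T, OneStep P Q → f P - f Q = w s(P.1, Q.1))
    (P : PathTo G d) : P ∈ T → f P = weight w P := by
  induction P using oneStep_induction with
  | nil => exact fun _ => hf
  | cons P Q h ih =>
    intro hP
    have hQ := hT P hP Q h.isSuffix
    linarith [hstep P hP Q hQ h, ih hQ, h.weight_eq w]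

theorem weight_nonneg {w : Sym2 N → ℤ} (hw : ∀ e ∈ G.edgeSet, 0 ≤ w e) (P : PathTo G d) :
    0 ≤ weight w P := by
  refine List.sum_nonneg fun x hx => ?_
  obtain ⟨e, he, rfl⟩ := List.mem_map.mp hx
  exact hw e (P.walk.edges_subset_edgeSet he)

theorem weight_le_length_mul {w : Sym2 N → ℤ} {c : ℤ} (hw : ∀ e ∈ G.edgeSet, w e ≤ c)
    (P : PathTo G d) : weight w P ≤ P.walk.length * c := by
  have h := List.sum_le_card_nsmul (P.walk.edges.map w) c fun x hx => by
    obtain ⟨e, he, rfl⟩ := List.mem_map.mp hx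
    exact hw e (P.walk.edges_subset_edgeSet he)
  simpa [weight] using h

end PathTo

theorem statement0 {N : Type*} [Fintype N]
    (G : SimpleGraph N) (d : N)
    (S : PathTo G d → PathTo G d → Prop)
    (wmax : ℤ) (hwmax : 0 ≤ wmax)
    (w : Sym2 N → ℤ) (lam : PathTo G d → ℤ)
    (S' : Set (PathTo G d))
    (hS' : S' = {P | ∃ Q R : PathTo G d, S Q R ∧
      (PathTo.IsSuffix P Q ∨ PathTo.IsSuffix P R)})
    -- (i) λ is 0 on the empty path
    (h1 : lam (PathTo.empty G d) = 0)
    -- (ii) λ is compatible with the edge weights along one-edge extensions within S'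
    (h2 : ∀ P ∈ S', ∀ Q ∈ S', PathTo.OneStep P Q → lam P - lam Q = w s(P.1, Q.1))
    -- (iii) the mandated preferences hold for λ
    (h3 : ∀ Q P : PathTo G d, S Q P → lam P - lam Q ≥ 1)
    -- (iv) the edge weights are between 0 and wmax
    (h4 : ∀ e ∈ G.edgeSet, 0 ≤ w e ∧ w e ≤ wmax)
    -- Λ agrees with λ on S', and is the path weight elsewhere
    (Lam : PathTo G d → ℤ)
    (hLam1 : ∀ P ∈ S', Lam P = lam P)
    (hLam2 : ∀ P ∉ S', Lam P = PathTo.weight w P) :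
    Lam (PathTo.empty G d) = 0 ∧
    (∀ P Q : PathTo G d, PathTo.OneStep P Q → Lam P - Lam Q = w s(P.1, Q.1)) ∧
    (∀ Q P : PathTo G d, S Q P → Lam P - Lam Q ≥ 1) ∧
    (∀ P : PathTo G d, 0 ≤ Lam P ∧ Lam P ≤ (Fintype.card N : ℤ) * wmax) := by
  have hclosed : ∀ P ∈ S', ∀ Q, PathTo.IsSuffix Q P → Q ∈ S' := by
    subst hS'
    rintro P ⟨A, B, hAB, hP⟩ Q hQ
    exact ⟨A, B, hAB, hP.imp hQ.trans hQ.trans⟩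
  have hLam : ∀ P, Lam P = PathTo.weight w P := fun P => by
    by_cases hP : P ∈ S'
    · rw [hLam1 P hP, PathTo.eq_weight_of_suffix_closed hclosed h1 h2 P hP]
    · exact hLam2 P hP
  refine ⟨by rw [hLam, PathTo.weight_empty], fun P Q h => ?_, fun Q P h => ?_, fun P => ?_⟩
  · rw [hLam, hLam, h.weight_eq w, add_sub_cancel_right]
  · have hQ : Q ∈ S' := by
      rw [hS']
      exact ⟨Q, P, h, Or.inl ⟨Walk.nil, rfl⟩⟩
    have hP : P ∈ S' := by
      rw [hS']
      exact ⟨Q, P, h, Or.inr ⟨Walk.nil, rfl⟩⟩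
    rw [hLam1 P hP, hLam1 Q hQ]
    exact h3 Q P h
  · rw [hLam]
    refine ⟨PathTo.weight_nonneg (fun e he => (h4 e he).1) P,
      (PathTo.weight_le_length_mul (fun e he => (h4 e he).2) P).trans ?_⟩
    have hlen : P.walk.length < Fintype.card N := P.2.2.length_lt
    gcongr
end

section
/- Let w : E → ℤ be an edge-weight function with w_e ≥ 1 for every edge e, and suppose that for every mandated preference (q,p) ∈ S_d the weight of q is strictly less than the weight of p. Then the directed graph whose nodes are the simple paths to d, with an arc from q to p whenever q is a proper suffix of p or (q,p) ∈ S_d, contains no directed cycle. -/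
/-!
Statement 4: If every edge weight is at least 1 and every mandated preference
`(q, p) ∈ S` has `weight q < weight p`, then the directed graph on the simple paths
to `d`, with an arc from `q` to `p` whenever `q` is a proper suffix of `p` or
`(q, p) ∈ S`, has no directed cycle.
-/

open SimpleGraph

/-- If all edges weigh at least `1`, the weight of a walk bounds its length. -/
theorem SimpleGraph.Walk.length_le_sum_map_edges {N : Type*} {G : SimpleGraph N}
    {w : Sym2 N → ℤ} (hw : ∀ e ∈ G.edgeSet, 1 ≤ w e) {u v : N} (r : G.Walk u v) :
    (r.length : ℤ) ≤ (r.edges.map w).sum := by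
  have h := List.card_nsmul_le_sum (r.edges.map w) 1 (by
    simpa using fun e he => hw e (r.edges_subset_edgeSet he))
  simpa using h

/-- If all edges weigh at least `1`, a proper suffix weighs strictly less. -/
theorem PathTo.IsProperSuffix.weight_lt {N : Type*} {G : SimpleGraph N} {d : N}
    {w : Sym2 N → ℤ} (hw : ∀ e ∈ G.edgeSet, 1 ≤ w e) {Q P : PathTo G d}
    (h : IsProperSuffix Q P) : weight w Q < weight w P := by
  obtain ⟨u, q, hq⟩ := Q
  obtain ⟨v, p, hp⟩ := P
  obtain ⟨⟨r, hr⟩, hne⟩ := h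
  dsimp only [walk] at r hr
  subst hr
  have hpos : 0 < r.length := by
    cases r with
    | nil => exact absurd rfl hne
    | cons _ _ => simp
  have hlen := r.length_le_sum_map_edges hw
  simp only [weight, walk, Walk.edges_append, List.map_append, List.sum_append]
  omega

theorem statement4 {N : Type*} [Fintype N]
    (G : SimpleGraph N) (d : N) (w : Sym2 N → ℤ)
    (S : PathTo G d → PathTo G d → Prop)
    (hw : ∀ e ∈ G.edgeSet, 1 ≤ w e)
    (hS : ∀ Q P : PathTo G d, S Q P → PathTo.weight w Q < PathTo.weight w P) :
    ∀ P : PathTo G d,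
      ¬ Relation.TransGen
        (fun Q P' : PathTo G d => PathTo.IsProperSuffix Q P' ∨ S Q P') P P := by
  intro P h
  have hlt := Relation.TransGen.trans_induction_on
    (motive := fun {Q P' : PathTo G d} _ => PathTo.weight w Q < PathTo.weight w P') h
    (fun h => h.elim (PathTo.IsProperSuffix.weight_lt hw) (hS _ _))
    (fun _ _ => lt_trans)
  exact lt_irrefl _ hlt
end

section
/- Let S'_d be the set consisting of all paths that occur in the mandated-preference relation S_d together with all of their suffixes, and assume S'_d contains ε_d. Suppose λ : S'_d → ℤ and w : E → ℤ satisfy: λ_{ε_d} = 0; λ_p − λ_q = w_{ij} whenever q ∈ S'_d and p ∈ S'_d is obtained from q by prepending an edge (i,j) ∈ E; and λ_p − λ_q ≥ 1 for every (q,p) ∈ S_d. Then for every mandated preference (q,p) ∈ S_d, the weight of q under w is strictly less than the weight of p under w. If moreover w_e ≥ 1 for every edge e, the directed graph on all simple paths to d with an arc from q to p whenever q is a proper suffix of p or (q,p) ∈ S_d contains no directed cycle. -/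
/-!
Statement 5: Let `S'` consist of all paths occurring in the mandated-preference
relation `S` together with all of their suffixes, and assume `ε_d ∈ S'`.  If `λ`
satisfies `λ ε_d = 0`, is compatible with the edge weights along one-edge extensions
within `S'`, and satisfies `λ p - λ q ≥ 1` for every `(q, p) ∈ S`, then every mandated
preference is realized by the path weights: `weight q < weight p` for `(q, p) ∈ S`.
Moreover, if every edge weight is at least 1, the directed graph on all simple paths
to `d` with an arc from `q` to `p` whenever `q` is a proper suffix of `p` or
`(q, p) ∈ S` has no directed cycle.
-/

open SimpleGraph

namespace PathTo

variable {N : Type*} {G : SimpleGraph N} {d : N}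

/-- A potential that vanishes on the empty path and is compatible with the edge weights along
one-edge extensions within a suffix-closed set agrees there with the path weight. -/
theorem eq_weight_of_oneStep (w : Sym2 N → ℤ) (lam : PathTo G d → ℤ) (T : Set (PathTo G d))
    (hT : ∀ P ∈ T, ∀ Q, IsSuffix Q P → Q ∈ T) (hnil : lam (empty G d) = 0)
    (hstep : ∀ P ∈ T, ∀ Q ∈ T, OneStep P Q → lam P - lam Q = w s(P.1, Q.1))
    {P : PathTo G d} (hP : P ∈ T) : lam P = weight w P := by
  obtain ⟨v, p, hp⟩ := P
  induction p with
  | nil => exact hnil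
  | @cons u v d hadj p ih =>
    have hone : OneStep (G := G) ⟨u, p.cons hadj, hp⟩ ⟨v, p, hp.of_cons⟩ := ⟨hadj, rfl⟩
    have hmem := hT _ hP _ hone.isSuffix
    have hrec := ih lam T hT hnil hstep hp.of_cons hmem
    have hdiff := hstep _ hP _ hmem hone
    simp only [weight, walk, SimpleGraph.Walk.edges_cons, List.map_cons, List.sum_cons]
      at hrec hdiff ⊢
    linarith

theorem IsProperSuffix.weight_lt_s5 {w : Sym2 N → ℤ} (hw : ∀ e ∈ G.edgeSet, 1 ≤ w e)
    {Q P : PathTo G d} (h : IsProperSuffix Q P) : weight w Q < weight w P := by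
  obtain ⟨v, q, hq⟩ := Q
  obtain ⟨u, p, hp⟩ := P
  obtain ⟨⟨r, hr⟩, hne⟩ := h
  simp only [walk] at r hr
  subst hr
  cases r with
  | nil => exact absurd rfl hne
  | cons hadj r =>
    have hpos : 0 ≤ (r.edges.map w).sum := List.sum_nonneg fun x hx => by
      obtain ⟨e, he, rfl⟩ := List.mem_map.1 hx
      exact zero_le_one.trans (hw e (r.edges_subset_edgeSet he))
    have hfirst := hw _ ((SimpleGraph.mem_edgeSet G).2 hadj)
    simp only [weight, walk, SimpleGraph.Walk.cons_append, SimpleGraph.Walk.edges_cons,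
      SimpleGraph.Walk.edges_append, List.map_cons, List.map_append, List.sum_cons,
      List.sum_append]
    linarith

end PathTo

theorem statement5 {N : Type*} [Fintype N]
    (G : SimpleGraph N) (d : N)
    (S : PathTo G d → PathTo G d → Prop)
    (w : Sym2 N → ℤ) (lam : PathTo G d → ℤ)
    (S' : Set (PathTo G d))
    (hS' : S' = {P | ∃ Q R : PathTo G d, S Q R ∧
      (PathTo.IsSuffix P Q ∨ PathTo.IsSuffix P R)})
    (hempty : PathTo.empty G d ∈ S')
    (h1 : lam (PathTo.empty G d) = 0)
    (h2 : ∀ P ∈ S', ∀ Q ∈ S', PathTo.OneStep P Q → lam P - lam Q = w s(P.1, Q.1))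
    (h3 : ∀ Q P : PathTo G d, S Q P → lam P - lam Q ≥ 1) :
    (∀ Q P : PathTo G d, S Q P → PathTo.weight w Q < PathTo.weight w P) ∧
    ((∀ e ∈ G.edgeSet, 1 ≤ w e) →
      ∀ P : PathTo G d,
        ¬ Relation.TransGen
          (fun Q P' : PathTo G d => PathTo.IsProperSuffix Q P' ∨ S Q P') P P) := by
  have hclosed : ∀ P ∈ S', ∀ Q, PathTo.IsSuffix Q P → Q ∈ S' := by
    subst hS'
    rintro P ⟨A, B, hAB, hP⟩ Q hQ
    exact ⟨A, B, hAB, hP.imp hQ.trans hQ.trans⟩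
  have hlam : ∀ P ∈ S', lam P = PathTo.weight w P := fun P hP =>
    PathTo.eq_weight_of_oneStep w lam S' hclosed h1 h2 hP
  have hpref : ∀ Q P : PathTo G d, S Q P → PathTo.weight w Q < PathTo.weight w P := by
    intro Q P hQP
    have hQ : Q ∈ S' := hS' ▸ ⟨Q, P, hQP, Or.inl ⟨SimpleGraph.Walk.nil, rfl⟩⟩
    have hP : P ∈ S' := hS' ▸ ⟨Q, P, hQP, Or.inr ⟨SimpleGraph.Walk.nil, rfl⟩⟩
    rw [← hlam Q hQ, ← hlam P hP]
    linarith [h3 Q P hQP]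
  refine ⟨hpref, fun hw P hP => ?_⟩
  have hlt : Relation.TransGen (fun a b : ℤ => a < b) (PathTo.weight w P) (PathTo.weight w P) :=
    hP.lift (PathTo.weight w) fun Q R hQR => hQR.elim (·.weight_lt hw) (hpref Q R)
  rw [Relation.transGen_eq_self] at hlt
  exact lt_irrefl _ hlt
end
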